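/- Instability and nonuniqueness in the regularized case: assume (1/2)·(d_x + 2)·(d_x + 1) < n, let ᾱ := (β̄, 0) be such that φ is continuously differentiable on an open neighborhood of (β̄, 0) and twice differentiable at (β̄, 0), and let g : ℝ^p × ℝ^{q×d_x} → [0, ∞) satisfy g(0) = 0 and g(z) ≥ c·‖z‖² for all z in some open neighborhood of the origin, where c > 0. Then there exist uncountably many pairs (ν, y_d) ∈ (0, ∞) × Y for which there are s₀ ≥ 0, a family (y^s)_{s > s₀} in Y, and an open neighborhood Ũ ⊆ ℝ^p × ℝ^{q×d_x} of ᾱ such that: y^s → y_d as s → s₀; for every s > s₀ no point of Ũ is a global minimizer of α ↦ ‖Ψ(α) − y^s‖_Y² + ν·g(α − ᾱ); and ᾱ is a global minimizer of α ↦ ‖Ψ(α) − y_d‖_Y² + ν·g(α − ᾱ). Moreover, there exist uncountably many such pairs (ν, y_d) for which additionally there is a family (α_s)_{s > s₀} with α_s ∉ Ũ for all s > s₀ and lim_{s → s₀} (‖Ψ(α_s) − y_d‖_Y² + ν·g(α_s − ᾱ)) = ‖Ψ(ᾱ) − y_d‖_Y² + ν·g(0). -/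

import Mathlib

noncomputable section

/-- The norm `‖y‖_Y = ((1/(2n)) · Σ_k ‖y_k‖₂²)^{1/2}` on `Y = (ℝ^{d_y})^n`. -/
def normY {dy n : ℕ} (y : Fin n → Fin dy → ℝ) : ℝ :=
  Real.sqrt (1 / (2 * (n : ℝ)) * ∑ k, ∑ j, y k j ^ 2)

/-- The approximation scheme with linear lowest level:
`Ψ(β, A) = (φ(β, A·x^k))_{k=1}^n`. -/
def PsiLin {dx dy n p q : ℕ} (x : Fin n → Fin dx → ℝ)
    (φ : (Fin p → ℝ) × (Fin q → ℝ) → Fin dy → ℝ)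
    (α : (Fin p → ℝ) × (Fin q → Fin dx → ℝ)) : Fin n → Fin dy → ℝ :=
  fun k => φ (α.1, fun i => ∑ j, α.2 i j * x k j)

/-- The regularized squared loss `α ↦ ‖Ψ(α) − y‖_Y² + ν·g(α − ᾱ)`. -/
def regLoss {dx dy n p q : ℕ} (x : Fin n → Fin dx → ℝ)
    (φ : (Fin p → ℝ) × (Fin q → ℝ) → Fin dy → ℝ)
    (g : (Fin p → ℝ) × (Fin q → Fin dx → ℝ) → ℝ)
    (abar : (Fin p → ℝ) × (Fin q → Fin dx → ℝ)) (ν : ℝ)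
    (y : Fin n → Fin dy → ℝ) (α : (Fin p → ℝ) × (Fin q → Fin dx → ℝ)) : ℝ :=
  normY (PsiLin x φ α - y) ^ 2 + ν * g (α - abar)

open Filter Topology Asymptotics

/-- A function that vanishes at a point together with its first two derivatives is
`o(‖x - a‖²)` there. -/
theorem isLittleO_norm_sub_sq_of_hasFDerivAt_zero {E F : Type*} [NormedAddCommGroup E]
    [NormedSpace ℝ E] [NormedAddCommGroup F] [NormedSpace ℝ F] {f : E → F} {f' : E → E →L[ℝ] F}
    {a : E} (hf : ∀ᶠ x in 𝓝 a, HasFDerivAt f (f' x) x) (hfa : f a = 0) (hf'a : f' a = 0)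
    (hf' : HasFDerivAt f' (0 : E →L[ℝ] E →L[ℝ] F) a) :
    f =o[𝓝 a] fun x => ‖x - a‖ ^ 2 := by
  rw [isLittleO_iff]
  intro ε hε
  have hsmall : ∀ᶠ x in 𝓝 a, ‖f' x‖ ≤ ε * ‖x - a‖ := by
    simpa [hf'a] using hf'.isLittleO.def hε
  obtain ⟨r, hr, hball⟩ := Metric.eventually_nhds_iff_ball.1 (hf.and hsmall)
  filter_upwards [Metric.ball_mem_nhds a hr] with x hx
  have hsub : Metric.closedBall a ‖x - a‖ ⊆ Metric.ball a r := by
    apply Metric.closedBall_subset_ball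
    rwa [← dist_eq_norm]
  have hmvt := (convex_closedBall a ‖x - a‖).norm_image_sub_le_of_norm_hasFDerivWithin_le
    (f := f) (f' := f') (C := ε * ‖x - a‖) (x := a) (y := x)
    (fun z hz => (hball z (hsub hz)).1.hasFDerivWithinAt)
    (fun z hz => (hball z (hsub hz)).2.trans
      (mul_le_mul_of_nonneg_left (by simpa [dist_eq_norm] using hz) hε.le))
    (Metric.mem_closedBall_self (norm_nonneg _)) (by simp [dist_eq_norm])
  rw [hfa, sub_zero] at hmvt
  rw [Real.norm_of_nonneg (by positivity)]
  linarith [sq ‖x - a‖, mul_assoc ε ‖x - a‖ ‖x - a‖]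

/-- If the weights `v` annihilate all moments of order at most two of the linear maps `L k`, then
the weighted sum of `φ ∘ L k` is `o(‖α - a‖²)`. -/
theorem isLittleO_weighted_sum_comp {ι E M F : Type*} [Fintype ι]
    [NormedAddCommGroup E] [NormedSpace ℝ E] [NormedAddCommGroup M] [NormedSpace ℝ M]
    [NormedAddCommGroup F] [NormedSpace ℝ F] {φ : M → F} {m : M} {a : E} {v : ι → ℝ}
    {L : ι → E →L[ℝ] M} (hφ1 : ∀ᶠ w in 𝓝 m, DifferentiableAt ℝ φ w)
    (hφ2 : DifferentiableAt ℝ (fderiv ℝ φ) m) (hLa : ∀ k, L k a = m)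
    (hv0 : ∑ k, v k = 0) (hv1 : ∀ h, ∑ k, v k • L k h = 0)
    (hv2 : ∀ (B : M →L[ℝ] M →L[ℝ] F) (h h' : E), ∑ k, v k • B (L k h) (L k h') = 0) :
    (fun α => ∑ k, v k • φ (L k α)) =o[𝓝 a] fun α => ‖α - a‖ ^ 2 := by
  have htend : ∀ k, Tendsto (L k) (𝓝 a) (𝓝 m) := fun k => hLa k ▸ (L k).continuous.tendsto a
  apply isLittleO_norm_sub_sq_of_hasFDerivAt_zero
    (f' := fun α => ∑ k, v k • (fderiv ℝ φ (L k α)).comp (L k))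
  · filter_upwards [eventually_all.2 fun k => (htend k).eventually hφ1] with α hα
    exact HasFDerivAt.fun_sum fun k _ =>
      ((hα k).hasFDerivAt.comp α (L k).hasFDerivAt).const_smul (v k)
  · simp [hLa, ← Finset.sum_smul, hv0]
  · ext h
    simpa [hLa] using congrArg (fderiv ℝ φ m) (hv1 h)
  · have hd : ∀ k, HasFDerivAt (fun α => v k • (fderiv ℝ φ (L k α)).comp (L k)) (v k •
        ((ContinuousLinearMap.compL ℝ E M F).flip (L k)).comp
          ((fderiv ℝ (fderiv ℝ φ) m).comp (L k))) a := by
      intro k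
      have hk : HasFDerivAt (fderiv ℝ φ) (fderiv ℝ (fderiv ℝ φ) m) (L k a) := by
        rw [hLa k]; exact hφ2.hasFDerivAt
      exact (((ContinuousLinearMap.compL ℝ E M F).flip (L k)).hasFDerivAt.comp a
        (hk.comp a (L k).hasFDerivAt)).const_smul (v k)
    have hzero : ∑ k, v k • ((ContinuousLinearMap.compL ℝ E M F).flip (L k)).comp
        ((fderiv ℝ (fderiv ℝ φ) m).comp (L k)) = 0 := by
      ext h h'
      simpa using hv2 (fderiv ℝ (fderiv ℝ φ) m) h h'
    exact hzero ▸ HasFDerivAt.fun_sum fun k (_ : k ∈ Finset.univ) => hd k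

/-- Fewer products `w k a * w k b` than indices `k` admit a common nonzero annihilator. -/
theorem exists_ne_zero_forall_sum_mul_mul_eq_zero {ι κ : Type*} [Fintype ι] [Fintype κ]
    (w : ι → κ → ℝ) (hcard : (Fintype.card κ + 1).choose 2 < Fintype.card ι) :
    ∃ v : ι → ℝ, v ≠ 0 ∧ ∀ a b, ∑ k, v k * (w k a * w k b) = 0 := by
  let T : (ι → ℝ) →ₗ[ℝ] Sym2 κ → ℝ := Fintype.linearCombination ℝ
    fun k => Sym2.lift ⟨fun a b => w k a * w k b, fun a b => mul_comm _ _⟩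
  have hker : T.ker ≠ ⊥ := LinearMap.ker_ne_bot_of_finrank_lt (by
    classical
    simpa [Sym2.card] using hcard)
  obtain ⟨v, hv, hv0⟩ := Submodule.exists_mem_ne_zero_of_ne_bot hker
  refine ⟨v, hv0, fun a b => ?_⟩
  have h := congrFun (LinearMap.mem_ker.1 hv) s(a, b)
  simpa [T, Fintype.linearCombination_apply, Finset.sum_apply] using h

/-- Bifurcation at the largest parameter `s₀` for which `a` minimizes `F - s₀ G`. The bound
`r * G α ≤ F α + r ^ 2 * Z` controls the values of `F - s₀ G` at better competitors. -/
theorem exists_critical_parameter {T : Type*} [TopologicalSpace T] {F G : T → ℝ} {a : T} {Z : ℝ}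
    (hF : ∀ α, 0 ≤ F α) (hFG : ∀ r α, r * G α ≤ F α + r ^ 2 * Z) (hG : ∃ α, 0 < G α)
    (hloc : ∀ S : ℝ, ∀ᶠ α in 𝓝 a, S * |G α| ≤ F α) :
    ∃ s₀ : ℝ, 0 ≤ s₀ ∧ (∀ α, s₀ * G α ≤ F α) ∧ ∃ U : Set T, IsOpen U ∧ a ∈ U ∧
      (∀ α ∈ U, ∀ s, 0 ≤ s → s ≤ s₀ + 1 → s * G α ≤ F α) ∧
      ∃ afam : ℝ → T, (∀ s, s₀ < s → afam s ∉ U ∧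
        F (afam s) < min s (s₀ + 1) * G (afam s)) ∧
        Tendsto (fun s => F (afam s) - s₀ * G (afam s)) (𝓝[>] s₀) (𝓝 0) := by
  let A : Set ℝ := {s | 0 ≤ s ∧ ∀ α, s * G α ≤ F α}
  obtain ⟨α₁, hα₁⟩ := hG
  have hA0 : (0 : ℝ) ∈ A := ⟨le_rfl, fun α => by simpa using hF α⟩
  have hAbdd : BddAbove A := ⟨F α₁ / G α₁, fun s hs => (le_div_iff₀ hα₁).2 (hs.2 α₁)⟩
  have hAclosed : IsClosed A := by
    have hAeq : A = Set.Ici 0 ∩ ⋂ α, {s | s * G α ≤ F α} := by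
      ext s; simp [A]
    rw [hAeq]
    exact isClosed_Ici.inter (isClosed_iInter fun α =>
      isClosed_le (continuous_id.mul continuous_const) continuous_const)
  set s₀ := sSup A
  obtain ⟨hs₀0, hs₀A⟩ : s₀ ∈ A := hAclosed.csSup_mem ⟨0, hA0⟩ hAbdd
  obtain ⟨U, hU, hUo, haU⟩ := eventually_nhds_iff.1 (hloc (s₀ + 1))
  have hUle : ∀ α ∈ U, ∀ s, 0 ≤ s → s ≤ s₀ + 1 → s * G α ≤ F α := fun α hα s h0 h1 =>
    calc s * G α ≤ s * |G α| := mul_le_mul_of_nonneg_left (le_abs_self _) h0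
      _ ≤ (s₀ + 1) * |G α| := mul_le_mul_of_nonneg_right h1 (abs_nonneg _)
      _ ≤ F α := hU α hα
  have hbetter : ∀ s, ∃ α, s₀ < s → F α < min s (s₀ + 1) * G α := by
    intro s
    by_cases hs : s₀ < s
    · by_contra! hcon
      have hlt : s₀ < min s (s₀ + 1) := lt_min hs (lt_add_one _)
      exact hlt.not_ge (le_csSup hAbdd ⟨hs₀0.trans hlt.le, fun α => (hcon α).2⟩)
    · exact ⟨a, fun h => absurd h hs⟩
  choose afam hafam using hbetter
  refine ⟨s₀, hs₀0, hs₀A, U, hUo, haU, hUle, afam, fun s hs => ⟨fun hmem => ?_, hafam s hs⟩, ?_⟩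
  · have hmin : 0 ≤ min s (s₀ + 1) := le_min (hs₀0.trans hs.le) (by linarith)
    exact (hafam s hs).not_ge (hUle _ hmem _ hmin (min_le_right _ _))
  · have hlim : Tendsto (fun s => (min s (s₀ + 1) - s₀) * (4 * min s (s₀ + 1) * Z))
        (𝓝[>] s₀) (𝓝 0) := by
      have hcont : Continuous fun s => (min s (s₀ + 1) - s₀) * (4 * min s (s₀ + 1) * Z) := by
        fun_prop
      have h := (hcont.tendsto s₀).mono_left (nhdsWithin_le_nhds (s := Set.Ioi s₀))
      simpa using h
    refine squeeze_zero' (Eventually.of_forall fun s => sub_nonneg.2 (hs₀A _)) ?_ hlim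
    filter_upwards [self_mem_nhdsWithin] with s (hs : s₀ < s)
    have hlt : s₀ < min s (s₀ + 1) := lt_min hs (lt_add_one _)
    have hlow := hafam s hs
    generalize min s (s₀ + 1) = t at hlt hlow
    have hbound := hFG (2 * t) (afam s)
    have hGle : G (afam s) ≤ 4 * t * Z :=
      le_of_mul_le_mul_left (by linarith) (hs₀0.trans_lt hlt)
    nlinarith [mul_le_mul_of_nonneg_left hGle (sub_nonneg.2 hlt.le)]

/-- Twice the inner product associated with `normY`. -/
def pairY {dy n : ℕ} (y z : Fin n → Fin dy → ℝ) : ℝ :=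
  1 / (n : ℝ) * ∑ k, ∑ j, y k j * z k j

theorem normY_sq {dy n : ℕ} (y : Fin n → Fin dy → ℝ) :
    normY y ^ 2 = 1 / (2 * (n : ℝ)) * ∑ k, ∑ j, y k j ^ 2 :=
  Real.sq_sqrt (by positivity)

theorem normY_sub_smul_sq {dy n : ℕ} (y z : Fin n → Fin dy → ℝ) (s : ℝ) :
    normY (y - s • z) ^ 2 = normY y ^ 2 - s * pairY y z + s ^ 2 * normY z ^ 2 := by
  have hterm : ∀ k j, (y - s • z) k j ^ 2 =
      y k j ^ 2 - 2 * s * (y k j * z k j) + s ^ 2 * z k j ^ 2 := fun k j => by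
    simp only [Pi.sub_apply, Pi.smul_apply, smul_eq_mul]; ring
  simp only [normY_sq, pairY, hterm, Finset.sum_add_distrib, Finset.sum_sub_distrib,
    ← Finset.mul_sum]
  rw [one_div, one_div, mul_inv]
  ring

theorem pairY_sub_left {dy n : ℕ} (y y' z : Fin n → Fin dy → ℝ) :
    pairY (y - y') z = pairY y z - pairY y' z := by
  simp only [pairY, Pi.sub_apply, sub_mul, Finset.sum_sub_distrib, mul_sub]

/-- The linear map `(β, A) ↦ (β, A·w)` of the lowest level. -/
def lowestLevel {dx p q : ℕ} (w : Fin dx → ℝ) :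
    ((Fin p → ℝ) × (Fin q → Fin dx → ℝ)) →L[ℝ] (Fin p → ℝ) × (Fin q → ℝ) :=
  LinearMap.toContinuousLinearMap
    { toFun := fun α => (α.1, fun i => ∑ j, α.2 i j * w j)
      map_add' := fun α α' => by
        ext i <;> simp [add_mul, Finset.sum_add_distrib]
      map_smul' := fun r α => by
        ext i <;> simp [Finset.mul_sum, mul_assoc] }

theorem lowestLevel_apply {dx p q : ℕ} (w : Fin dx → ℝ)
    (α : (Fin p → ℝ) × (Fin q → Fin dx → ℝ)) :
    lowestLevel w α = (α.1, fun i => ∑ j, α.2 i j * w j) := rfl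

/-- The affine coordinates `(1, w)` of a point `w`. -/
def affineCoord {dx : ℕ} (w : Fin dx → ℝ) : Option (Fin dx) → ℝ
  | none => 1
  | some j => w j

/-- The coefficients of `lowestLevel w` with respect to the affine coordinates of `w`. -/
def lowestLevelCoeff {dx p q : ℕ} (α : (Fin p → ℝ) × (Fin q → Fin dx → ℝ)) :
    Option (Fin dx) → (Fin p → ℝ) × (Fin q → ℝ)
  | none => (α.1, 0)
  | some j => (0, fun i => α.2 i j)

theorem lowestLevel_eq_sum {dx p q : ℕ} (w : Fin dx → ℝ)
    (α : (Fin p → ℝ) × (Fin q → Fin dx → ℝ)) :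
    lowestLevel w α = ∑ a, affineCoord w a • lowestLevelCoeff α a := by
  ext i
  · simp [lowestLevel_apply, affineCoord, lowestLevelCoeff, Fintype.sum_option, Prod.fst_sum]
  · simp [lowestLevel_apply, affineCoord, lowestLevelCoeff, Fintype.sum_option, Prod.snd_sum,
      mul_comm]

/-- If `v` annihilates all polynomials of degree at most two on the data `x`, then the weighted
sum of the outputs of the scheme vanishes to second order at `(β, 0)`. -/
theorem isLittleO_weighted_sum_PsiLin {dx dy n p q : ℕ} {x : Fin n → Fin dx → ℝ}
    {φ : (Fin p → ℝ) × (Fin q → ℝ) → Fin dy → ℝ} {β : Fin p → ℝ} {v : Fin n → ℝ}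
    (hφ1 : ∀ᶠ w in 𝓝 (β, (0 : Fin q → ℝ)), DifferentiableAt ℝ φ w)
    (hφ2 : DifferentiableAt ℝ (fderiv ℝ φ) (β, (0 : Fin q → ℝ)))
    (hv : ∀ a b, ∑ k, v k * (affineCoord (x k) a * affineCoord (x k) b) = 0) :
    (fun α => ∑ k, v k • PsiLin x φ α k) =o[𝓝 (β, (0 : Fin q → Fin dx → ℝ))]
      fun α => ‖α - (β, 0)‖ ^ 2 := by
  have hv1 : ∀ a, ∑ k, v k * affineCoord (x k) a = 0 := fun a => by
    simpa [affineCoord] using hv a none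
  refine isLittleO_weighted_sum_comp (L := fun k => lowestLevel (x k)) hφ1 hφ2
    (fun k => ?_) (by simpa [affineCoord] using hv1 none) (fun h => ?_) (fun B h h' => ?_)
  · simp only [lowestLevel_apply, Pi.zero_apply, zero_mul, Finset.sum_const_zero]
    rfl
  · simp only [lowestLevel_eq_sum, Finset.smul_sum, smul_smul]
    rw [Finset.sum_comm]
    simp [← Finset.sum_smul, hv1]
  · simp only [lowestLevel_eq_sum, map_sum, map_smul, sum_apply, smul_apply,
      Finset.smul_sum, smul_smul]
    rw [Finset.sum_comm]
    refine Finset.sum_eq_zero fun a _ => ?_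
    rw [Finset.sum_comm]
    refine Finset.sum_eq_zero fun b _ => ?_
    rw [← Finset.sum_smul, hv a b, zero_smul]

theorem regularized_instability_nonuniqueness
    (dx dy n p q : ℕ) (hn : 2 ≤ n) (hdx : 1 ≤ dx) (hdy : 1 ≤ dy)
    (hp : 1 ≤ p) (hq : 1 ≤ q)
    (hbig : (dx + 2) * (dx + 1) < 2 * n)
    (x : Fin n → Fin dx → ℝ)
    (φ : (Fin p → ℝ) × (Fin q → ℝ) → Fin dy → ℝ)
    (hcone : ∀ y ∈ Set.range (PsiLin x φ), ∀ s : ℝ, 0 < s →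
      s • y ∈ Set.range (PsiLin x φ))
    (hexpr : ∀ y : Fin n → Fin dy → ℝ, y ≠ 0 →
      sInf (Set.range fun α => normY (PsiLin x φ α - y) ^ 2) < normY y ^ 2)
    (βbar : Fin p → ℝ)
    (hφ1 : ∃ U : Set ((Fin p → ℝ) × (Fin q → ℝ)),
      IsOpen U ∧ (βbar, (0 : Fin q → ℝ)) ∈ U ∧ ContDiffOn ℝ 1 φ U)
    (hφ2 : DifferentiableAt ℝ (fderiv ℝ φ) (βbar, (0 : Fin q → ℝ)))
    (g : (Fin p → ℝ) × (Fin q → Fin dx → ℝ) → ℝ)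
    (hgnn : ∀ z, 0 ≤ g z) (hg0 : g 0 = 0)
    (hgq : ∃ c : ℝ, 0 < c ∧ ∃ U : Set ((Fin p → ℝ) × (Fin q → Fin dx → ℝ)),
      IsOpen U ∧ (0 : (Fin p → ℝ) × (Fin q → Fin dx → ℝ)) ∈ U ∧
      ∀ z ∈ U, c * ‖z‖ ^ 2 ≤ g z) :
    ¬ Set.Countable {νy : ℝ × (Fin n → Fin dy → ℝ) | 0 < νy.1 ∧
      ∃ s₀ : ℝ, 0 ≤ s₀ ∧ ∃ yfam : ℝ → Fin n → Fin dy → ℝ,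
        ∃ Ut : Set ((Fin p → ℝ) × (Fin q → Fin dx → ℝ)),
          IsOpen Ut ∧ (βbar, (0 : Fin q → Fin dx → ℝ)) ∈ Ut ∧
          Filter.Tendsto yfam (nhdsWithin s₀ (Set.Ioi s₀)) (nhds νy.2) ∧
          (∀ s : ℝ, s₀ < s → ∀ α ∈ Ut, ∃ α',
            regLoss x φ g (βbar, 0) νy.1 (yfam s) α' <
              regLoss x φ g (βbar, 0) νy.1 (yfam s) α) ∧
          (∀ α, regLoss x φ g (βbar, 0) νy.1 νy.2 (βbar, 0) ≤
            regLoss x φ g (βbar, 0) νy.1 νy.2 α)} ∧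
    ¬ Set.Countable {νy : ℝ × (Fin n → Fin dy → ℝ) | 0 < νy.1 ∧
      ∃ s₀ : ℝ, 0 ≤ s₀ ∧ ∃ yfam : ℝ → Fin n → Fin dy → ℝ,
        ∃ Ut : Set ((Fin p → ℝ) × (Fin q → Fin dx → ℝ)),
          IsOpen Ut ∧ (βbar, (0 : Fin q → Fin dx → ℝ)) ∈ Ut ∧
          Filter.Tendsto yfam (nhdsWithin s₀ (Set.Ioi s₀)) (nhds νy.2) ∧
          (∀ s : ℝ, s₀ < s → ∀ α ∈ Ut, ∃ α',
            regLoss x φ g (βbar, 0) νy.1 (yfam s) α' <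
              regLoss x φ g (βbar, 0) νy.1 (yfam s) α) ∧
          (∀ α, regLoss x φ g (βbar, 0) νy.1 νy.2 (βbar, 0) ≤
            regLoss x φ g (βbar, 0) νy.1 νy.2 α) ∧
          ∃ afam : ℝ → (Fin p → ℝ) × (Fin q → Fin dx → ℝ),
            (∀ s : ℝ, s₀ < s → afam s ∉ Ut) ∧
            Filter.Tendsto (fun s => regLoss x φ g (βbar, 0) νy.1 νy.2 (afam s))
              (nhdsWithin s₀ (Set.Ioi s₀))
              (nhds (normY (PsiLin x φ (βbar, 0) - νy.2) ^ 2 + νy.1 * g 0))} := by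
  obtain ⟨v, hv0, hv⟩ := exists_ne_zero_forall_sum_mul_mul_eq_zero
    (fun k => affineCoord (x k)) (by
      simp only [Fintype.card_option, Fintype.card_fin, Nat.choose_two_right, Nat.add_sub_cancel]
      exact Nat.div_lt_of_lt_mul hbig)
  have hφd : ∀ᶠ w in 𝓝 (βbar, (0 : Fin q → ℝ)), DifferentiableAt ℝ φ w := by
    obtain ⟨U, hUo, hmU, hU⟩ := hφ1
    filter_upwards [hUo.mem_nhds hmU] with w hw
    exact (hU.contDiffAt (hUo.mem_nhds hw)).differentiableAt one_ne_zero
  let z : Fin n → Fin dy → ℝ := fun k _ => v k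
  let G := fun α => pairY (PsiLin x φ α) z
  have hz0 : z ≠ 0 := fun h => hv0 (funext fun k => congrFun (congrFun h k) ⟨0, hdy⟩)
  have hGsum : ∀ α, G α = 1 / (n : ℝ) * ∑ j, (∑ k, v k • PsiLin x φ α k) j := fun α => by
    simp only [G, z, pairY, Finset.sum_apply, Pi.smul_apply, smul_eq_mul]
    rw [Finset.sum_comm]
    simp only [mul_comm]
  have hGa : G (βbar, 0) = 0 := by
    have hv00 : ∑ k, v k = 0 := by simpa [affineCoord] using hv none none
    simp [hGsum, PsiLin, ← Finset.sum_mul, hv00]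
  have hGo : G =o[𝓝 (βbar, (0 : Fin q → Fin dx → ℝ))] fun α => ‖α - (βbar, 0)‖ ^ 2 := by
    rw [funext hGsum]
    exact (IsLittleO.fun_sum fun j _ =>
      isLittleO_pi.1 (isLittleO_weighted_sum_PsiLin hφd hφ2 hv) j).const_mul_left _
  have hGpos : ∃ α, 0 < G α := by
    obtain ⟨_, ⟨α, rfl⟩, hα⟩ := exists_lt_of_csInf_lt (Set.range_nonempty _) (hexpr z hz0)
    have hexpand := normY_sub_smul_sq (PsiLin x φ α) z 1
    rw [one_smul] at hexpand
    exact ⟨α, by simp only [G]; nlinarith [sq_nonneg (normY (PsiLin x φ α))]⟩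
  obtain ⟨c, hc, U, hUo, h0U, hU⟩ := hgq
  let ybar := PsiLin x φ (βbar, 0)
  have hexpand : ∀ ν s α, regLoss x φ g (βbar, 0) ν (ybar + s • z) α =
      normY (PsiLin x φ α - ybar) ^ 2 + ν * g (α - (βbar, 0)) - s * G α
        + s ^ 2 * normY z ^ 2 := fun ν s α => by
    rw [regLoss, ← sub_sub, normY_sub_smul_sq, pairY_sub_left]
    change _ - s * (G α - G (βbar, 0)) + _ + _ = _
    rw [hGa]
    ring
  have hbar : ∀ ν s, regLoss x φ g (βbar, 0) ν (ybar + s • z) (βbar, 0) =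
      s ^ 2 * normY z ^ 2 := fun ν s => by
    rw [hexpand, hGa, sub_self, sub_self, hg0, normY_sq]
    simp
  have hmain : ∀ ν : ℝ, 0 < ν → ∃ s₀ : ℝ, 0 ≤ s₀ ∧ ∃ yfam : ℝ → Fin n → Fin dy → ℝ,
      ∃ Ut : Set ((Fin p → ℝ) × (Fin q → Fin dx → ℝ)),
        IsOpen Ut ∧ (βbar, (0 : Fin q → Fin dx → ℝ)) ∈ Ut ∧
        Tendsto yfam (𝓝[>] s₀) (𝓝 (ybar + s₀ • z)) ∧
        (∀ s : ℝ, s₀ < s → ∀ α ∈ Ut, ∃ α',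
          regLoss x φ g (βbar, 0) ν (yfam s) α' < regLoss x φ g (βbar, 0) ν (yfam s) α) ∧
        (∀ α, regLoss x φ g (βbar, 0) ν (ybar + s₀ • z) (βbar, 0) ≤
          regLoss x φ g (βbar, 0) ν (ybar + s₀ • z) α) ∧
        ∃ afam : ℝ → (Fin p → ℝ) × (Fin q → Fin dx → ℝ),
          (∀ s : ℝ, s₀ < s → afam s ∉ Ut) ∧
          Tendsto (fun s => regLoss x φ g (βbar, 0) ν (ybar + s₀ • z) (afam s)) (𝓝[>] s₀)
            (𝓝 (normY (PsiLin x φ (βbar, 0) - (ybar + s₀ • z)) ^ 2 + ν * g 0)) := by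
    intro ν hν
    have hFnn : ∀ α, 0 ≤ normY (PsiLin x φ α - ybar) ^ 2 + ν * g (α - (βbar, 0)) :=
      fun α => add_nonneg (sq_nonneg _) (mul_nonneg hν.le (hgnn _))
    obtain ⟨s₀, hs₀, hmin, Ut, hUto, haUt, hUtle, afam, hafam, hlim⟩ :=
      exists_critical_parameter (a := (βbar, (0 : Fin q → Fin dx → ℝ))) (G := G)
        (Z := normY z ^ 2) hFnn
        (fun r α => by
          have hnn : 0 ≤ regLoss x φ g (βbar, 0) ν (ybar + r • z) α :=
            add_nonneg (sq_nonneg _) (mul_nonneg hν.le (hgnn _))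
          rw [hexpand] at hnn
          linarith) hGpos
        (fun S => by
          have hsub : Tendsto (fun α => α - (βbar, (0 : Fin q → Fin dx → ℝ)))
              (𝓝 (βbar, 0)) (𝓝 0) := tendsto_sub_nhds_zero_iff.2 tendsto_id
          have hS : 0 < |S| + 1 := by positivity
          filter_upwards [hGo.def (div_pos (mul_pos hν hc) hS),
            hsub.eventually (hUo.mem_nhds h0U)] with α hα hαU
          rw [Real.norm_eq_abs, Real.norm_of_nonneg (by positivity), div_mul_eq_mul_div,
            le_div_iff₀ hS] at hα
          calc S * |G α| ≤ |G α| * (|S| + 1) := by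
                nlinarith [le_abs_self S, abs_nonneg (G α)]
            _ ≤ ν * (c * ‖α - (βbar, 0)‖ ^ 2) := by linarith
            _ ≤ ν * g (α - (βbar, 0)) := mul_le_mul_of_nonneg_left (hU _ hαU) hν.le
            _ ≤ _ := le_add_of_nonneg_left (sq_nonneg _))
    refine ⟨s₀, hs₀, fun s => ybar + min s (s₀ + 1) • z, Ut, hUto, haUt, ?_, ?_, ?_, afam,
      fun s hs => (hafam s hs).1, ?_⟩
    · have hcont : Continuous fun s => ybar + min s (s₀ + 1) • z := by fun_prop
      simpa using (hcont.tendsto s₀).mono_left (nhdsWithin_le_nhds (s := Set.Ioi s₀))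
    · intro s hs α hα
      refine ⟨afam s, ?_⟩
      have hle := hUtle α hα (min s (s₀ + 1))
        (le_min (hs₀.trans hs.le) (by linarith)) (min_le_right _ _)
      have hlt := (hafam s hs).2
      rw [hexpand, hexpand]
      linarith
    · intro α
      rw [hbar, hexpand]
      linarith [hmin α]
    · have htarget : normY (PsiLin x φ (βbar, 0) - (ybar + s₀ • z)) ^ 2 + ν * g 0 =
          0 + s₀ ^ 2 * normY z ^ 2 := by
        rw [zero_add, ← hbar ν s₀, regLoss, sub_self]
      simp only [htarget, hexpand]
      exact hlim.add_const _
  have huncountable : ∀ T : Set (ℝ × (Fin n → Fin dy → ℝ)),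
      (∀ ν, 0 < ν → ∃ y, (ν, y) ∈ T) → ¬ T.Countable := fun T hT hcount => by
    have hIoi : (Set.Ioi (0 : ℝ)).Countable := (hcount.image Prod.fst).mono fun ν hν => by
      obtain ⟨y, hy⟩ := hT ν hν
      exact ⟨(ν, y), hy, rfl⟩
    rw [← Cardinal.le_aleph0_iff_set_countable, Cardinal.mk_Ioi_real] at hIoi
    exact hIoi.not_gt Cardinal.aleph0_lt_continuum
  refine ⟨huncountable _ fun ν hν => ?_, huncountable _ fun ν hν => ?_⟩
  · obtain ⟨s₀, hs₀, yfam, Ut, hUto, haUt, hy, hbetter, hmin, -⟩ := hmain ν hν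
    exact ⟨ybar + s₀ • z, hν, s₀, hs₀, yfam, Ut, hUto, haUt, hy, hbetter, hmin⟩
  · obtain ⟨s₀, h⟩ := hmain ν hν
    exact ⟨ybar + s₀ • z, hν, s₀, h⟩
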